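/- arXiv:1410.2927 — 2 statements merged into one kernel-verified Lean document; each statement's English description precedes it below -/
import Mathlib

section
/- Let θ be real with 1 < θ < e³ and log θ irrational, and let A_k/B_k denote the convergents (in lowest terms) of the simple continued fraction expansion of 2/log θ. If n ∈ A_θ, then there exist positive integers c and k such that n = c·B_{2k−1} and 0 < A_{2k−1}/B_{2k−1} − 2/log θ < log θ/(6 c² B_{2k−1}²). (Equivalently, in the paper's notation, λ_{2k} > 6c²/log θ, since 2/log θ − A_{2k−1}/B_{2k−1} = −1/(B_{2k−1}² λ_{2k}).) -/
/-- The set of atypical numbers `A_θ`, defined via `M'_θ(n) = ⌊1/(θ^{1/n} - 1)⌋`. -/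
noncomputable def Atheta (θ : ℝ) : Set ℕ :=
  {n | 0 < n ∧ ⌊(θ ^ ((n : ℝ))⁻¹ - 1)⁻¹⌋ ≠ ⌊(n : ℝ) / Real.log θ - 1 / 2⌋}

/-- The iterates of the continued fraction (Gauss) algorithm on `α`. -/
noncomputable def cfX (α : ℝ) : ℕ → ℝ
  | 0 => α
  | k + 1 => (Int.fract (cfX α k))⁻¹

/-- The `k`-th partial quotient of the simple continued fraction of `α`. -/
noncomputable def cfA (α : ℝ) (k : ℕ) : ℤ := ⌊cfX α k⌋

/-- The pair `(A_k, B_k)` of numerator and denominator of the `k`-th convergent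
`A_k / B_k = [a₀; a₁, …, a_k]` of the continued fraction of `α`. -/
noncomputable def cfConv (α : ℝ) : ℕ → ℤ × ℤ
  | 0 => (cfA α 0, 1)
  | 1 => (cfA α 1 * cfA α 0 + 1, cfA α 1)
  | (k + 2) => (cfA α (k + 2) * (cfConv α (k + 1)).1 + (cfConv α k).1,
                cfA α (k + 2) * (cfConv α (k + 1)).2 + (cfConv α k).2)

theorem pos_of_deriv_pos {f f' : ℝ → ℝ} (hf : ∀ x, HasDerivAt f (f' x) x) (h0 : f 0 = 0)
    (hpos : ∀ x, 0 < x → 0 < f' x) {x : ℝ} (hx : 0 < x) : 0 < f x := by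
  have hmono : StrictMonoOn f (Set.Ici 0) := by
    refine strictMonoOn_of_deriv_pos (convex_Ici 0)
      (fun y _ => (hf y).continuousAt.continuousWithinAt) fun y hy => ?_
    rw [interior_Ici] at hy
    rw [(hf y).deriv]
    exact hpos y hy
  have := hmono (Set.mem_Ici.2 le_rfl) (Set.mem_Ici.2 hx.le) hx
  rwa [h0] at this

theorem exp_mul_two_sub_lt {x : ℝ} (hx : 0 < x) : Real.exp x * (2 - x) < 2 + x := by
  have key := pos_of_deriv_pos (f := fun y => 2 + y - Real.exp y * (2 - y))
    (f' := fun y => 1 - (Real.exp y * (2 - y) + Real.exp y * (-1)))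
    (fun y => ((hasDerivAt_id y).const_add 2).sub
      ((Real.hasDerivAt_exp y).mul ((hasDerivAt_id y).const_sub 2)))
    (by simp) (fun y hy => ?_) hx
  · simpa using key
  · have h1 := Real.add_one_lt_exp (neg_ne_zero.2 hy.ne')
    have h2 := mul_lt_mul_of_pos_left h1 (Real.exp_pos y)
    rw [← Real.exp_add, add_neg_cancel, Real.exp_zero] at h2
    linarith

theorem lt_exp_mul_quadratic {x : ℝ} (hx : 0 < x) :
    x ^ 2 + 6 * x + 12 < Real.exp x * (x ^ 2 - 6 * x + 12) := by
  have hquad : ∀ b c y : ℝ, HasDerivAt (fun z : ℝ => z ^ 2 + b * z + c) (2 * y + b) y := by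
    intro b c y
    simpa using (((hasDerivAt_id y).pow 2).add ((hasDerivAt_id y).const_mul b)).add_const c
  have hexp : ∀ b c y : ℝ, HasDerivAt (fun z : ℝ => Real.exp z * (z ^ 2 + b * z + c))
      (Real.exp y * (y ^ 2 + (b + 2) * y + (b + c))) y := by
    intro b c y
    exact ((Real.hasDerivAt_exp y).mul (hquad b c y)).congr_deriv (by ring)
  have h2 : ∀ y : ℝ, 0 < y → 0 < Real.exp y * (y ^ 2 + (-2) * y + 2) - 2 := fun y hy =>
    pos_of_deriv_pos (f := fun z => Real.exp z * (z ^ 2 + (-2) * z + 2) - 2)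
      (fun z => (hexp (-2) 2 z).sub_const 2) (by simp)
      (fun z hz => by norm_num; positivity) hy
  have h1 : ∀ y : ℝ, 0 < y → 0 < Real.exp y * (y ^ 2 + (-4) * y + 6) - (2 * y + 6) := fun y hy =>
    pos_of_deriv_pos (f := fun z => Real.exp z * (z ^ 2 + (-4) * z + 6) - (2 * z + 6))
      (fun z => (hexp (-4) 6 z).sub (((hasDerivAt_id z).const_mul 2).add_const 6)) (by simp)
      (fun z hz => by have := h2 z hz; norm_num at this ⊢; exact this) hy
  have h0 := pos_of_deriv_pos
    (f := fun z => Real.exp z * (z ^ 2 + (-6) * z + 12) - (z ^ 2 + 6 * z + 12))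
    (fun z => (hexp (-6) 12 z).sub (hquad 6 12 z)) (by simp)
    (fun z hz => by have := h1 z hz; norm_num at this ⊢; exact this) hx
  linarith

theorem inv_sub_half_lt_inv_exp_sub_one {x : ℝ} (hx : 0 < x) :
    x⁻¹ - 1 / 2 < (Real.exp x - 1)⁻¹ := by
  have he : 0 < Real.exp x - 1 := by linarith [Real.add_one_lt_exp hx.ne']
  have h := exp_mul_two_sub_lt hx
  rw [show x⁻¹ - 1 / 2 = (2 - x) / (2 * x) by field_simp, inv_eq_one_div,
    div_lt_div_iff₀ (by positivity) he]
  linarith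

theorem inv_exp_sub_one_lt {x : ℝ} (hx : 0 < x) :
    (Real.exp x - 1)⁻¹ < x⁻¹ - 1 / 2 + x / 12 := by
  have he : 0 < Real.exp x - 1 := by linarith [Real.add_one_lt_exp hx.ne']
  have h := lt_exp_mul_quadratic hx
  rw [show x⁻¹ - 1 / 2 + x / 12 = (x ^ 2 - 6 * x + 12) / (12 * x) by field_simp; ring,
    inv_eq_one_div, div_lt_div_iff₀ he (by positivity)]
  linarith

theorem exists_int_of_mem_Atheta {θ : ℝ} (hθ : 1 < θ) {n : ℕ} (hn : n ∈ Atheta θ) :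
    ∃ m : ℤ, (n : ℝ) / Real.log θ - 1 / 2 < m ∧
      (m : ℝ) < n / Real.log θ - 1 / 2 + Real.log θ / (12 * n) := by
  obtain ⟨hn0, hne⟩ := hn
  have hL : 0 < Real.log θ := Real.log_pos hθ
  have hn' : (0 : ℝ) < n := by exact_mod_cast hn0
  have hx : 0 < Real.log θ / n := by positivity
  have h1 := inv_sub_half_lt_inv_exp_sub_one hx
  have h2 := inv_exp_sub_one_lt hx
  rw [Real.rpow_def_of_pos (by linarith), ← div_eq_mul_inv] at hne
  rw [inv_div] at h1 h2
  refine ⟨_, Int.floor_lt.1 (lt_of_le_of_ne (Int.floor_mono h1.le) hne.symm),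
    (Int.floor_le _).trans_lt (h2.trans_le (le_of_eq ?_))⟩
  rw [div_div, mul_comm (n : ℝ) 12]

theorem cfX_succ (α : ℝ) (k : ℕ) : cfX α (k + 1) = cfX (Int.fract α)⁻¹ k := by
  induction k with
  | zero => rfl
  | succ k ih => rw [cfX, ih, cfX]

theorem cfConv_succ (α : ℝ) (k : ℕ) :
    cfConv α (k + 1) = (⌊α⌋ * (cfConv (Int.fract α)⁻¹ k).1 + (cfConv (Int.fract α)⁻¹ k).2,
      (cfConv (Int.fract α)⁻¹ k).1) := by
  induction k using Nat.twoStepInduction with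
  | zero => simp [cfConv, cfA, cfX, mul_comm]
  | one =>
    simp only [cfConv, cfA, cfX, Prod.mk.injEq]
    exact ⟨by ring, trivial⟩
  | more k ih1 ih2 =>
    rw [cfConv, ih1, ih2, cfConv, cfA, cfA, cfX_succ]
    simp only [Prod.mk.injEq]
    exact ⟨by ring, trivial⟩

theorem irrational_inv_fract {α : ℝ} (hα : Irrational α) : Irrational (Int.fract α)⁻¹ := by
  rw [irrational_inv_iff, Int.fract]
  exact hα.sub_intCast _

theorem fract_pos_of_irrational {α : ℝ} (hα : Irrational α) : 0 < Int.fract α :=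
  Int.fract_pos.2 (hα.ne_int _)

theorem one_lt_inv_fract {α : ℝ} (hα : Irrational α) : 1 < (Int.fract α)⁻¹ :=
  (one_lt_inv₀ (fract_pos_of_irrational hα)).2 (Int.fract_lt_one α)

theorem cfConv_pos {α : ℝ} (hα : Irrational α) (h1 : 1 < α) (k : ℕ) :
    0 < (cfConv α k).1 ∧ 0 < (cfConv α k).2 := by
  induction k generalizing α with
  | zero => exact ⟨Int.floor_pos.2 h1.le, one_pos⟩
  | succ k ih =>
    obtain ⟨hA, hB⟩ := ih (irrational_inv_fract hα) (one_lt_inv_fract hα)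
    have hfl : 0 < ⌊α⌋ := Int.floor_pos.2 h1.le
    rw [cfConv_succ]
    exact ⟨by positivity, hA⟩

theorem cfConv_snd_pos {α : ℝ} (hα : Irrational α) (k : ℕ) : 0 < (cfConv α k).2 := by
  cases k with
  | zero => exact one_pos
  | succ k =>
    rw [cfConv_succ]
    exact (cfConv_pos (irrational_inv_fract hα) (one_lt_inv_fract hα) k).1

theorem isCoprime_cfConv (α : ℝ) (k : ℕ) : IsCoprime (cfConv α k).1 (cfConv α k).2 := by
  induction k generalizing α with
  | zero => exact isCoprime_one_right
  | succ k ih =>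
    rw [cfConv_succ]
    exact IsCoprime.mul_add_right_left (ih _).symm _

theorem cfConv_div_succ {α : ℝ} (hα : Irrational α) (k : ℕ) :
    ((cfConv α (k + 1)).1 : ℝ) / (cfConv α (k + 1)).2 =
      ⌊α⌋ + (((cfConv (Int.fract α)⁻¹ k).1 : ℝ) / (cfConv (Int.fract α)⁻¹ k).2)⁻¹ := by
  have hA : ((cfConv (Int.fract α)⁻¹ k).1 : ℝ) ≠ 0 := by
    exact_mod_cast (cfConv_pos (irrational_inv_fract hα) (one_lt_inv_fract hα) k).1.ne'
  rw [cfConv_succ, inv_div]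
  push_cast
  rw [add_div, mul_div_cancel_right₀ _ hA]

theorem cfConv_div_eq_convergent {α : ℝ} (hα : Irrational α) (k : ℕ) :
    ((cfConv α k).1 : ℝ) / (cfConv α k).2 = (α.convergent k : ℝ) := by
  induction k generalizing α with
  | zero => simp [cfConv, cfA, cfX]
  | succ k ih =>
    rw [cfConv_div_succ hα, ih (irrational_inv_fract hα), Real.convergent_succ]
    push_cast
    rfl

theorem cfConv_div_lt_iff_even {α : ℝ} (hα : Irrational α) (k : ℕ) :
    ((cfConv α k).1 : ℝ) / (cfConv α k).2 < α ↔ Even k := by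
  induction k generalizing α with
  | zero => simpa [cfConv, cfA, cfX] using (Int.floor_le α).lt_of_ne (hα.ne_int _).symm
  | succ k ih =>
    have hα' := irrational_inv_fract hα
    obtain ⟨hA, hB⟩ := cfConv_pos hα' (one_lt_inv_fract hα) k
    have hpos : (0 : ℝ) < (cfConv (Int.fract α)⁻¹ k).1 / (cfConv (Int.fract α)⁻¹ k).2 :=
      div_pos (by exact_mod_cast hA) (by exact_mod_cast hB)
    have hne : ((cfConv (Int.fract α)⁻¹ k).1 : ℝ) / (cfConv (Int.fract α)⁻¹ k).2 ≠
        (Int.fract α)⁻¹ := by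
      rw [cfConv_div_eq_convergent hα']
      exact (hα'.ne_rat _).symm
    rw [Nat.even_add_one, ← ih hα', cfConv_div_succ hα, ← lt_sub_iff_add_lt', Int.self_sub_floor,
      inv_lt_comm₀ hpos (fract_pos_of_irrational hα), not_lt]
    exact ⟨le_of_lt, fun h => lt_of_le_of_ne h hne.symm⟩

theorem stmt13 (θ : ℝ) (hθ1 : 1 < θ) (hθ2 : θ < Real.exp 3)
    (hirr : Irrational (Real.log θ)) (n : ℕ) (hn : n ∈ Atheta θ) :
    ∃ c k : ℕ, 0 < c ∧ 0 < k ∧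
      (n : ℤ) = (c : ℤ) * (cfConv (2 / Real.log θ) (2 * k - 1)).2 ∧
      (0 < ((cfConv (2 / Real.log θ) (2 * k - 1)).1 : ℝ) /
            ((cfConv (2 / Real.log θ) (2 * k - 1)).2 : ℝ) - 2 / Real.log θ ∧
       ((cfConv (2 / Real.log θ) (2 * k - 1)).1 : ℝ) /
            ((cfConv (2 / Real.log θ) (2 * k - 1)).2 : ℝ) - 2 / Real.log θ <
         Real.log θ /
           (6 * (c : ℝ) ^ 2 * ((cfConv (2 / Real.log θ) (2 * k - 1)).2 : ℝ) ^ 2)) := by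
  have hL : 0 < Real.log θ := Real.log_pos hθ1
  have hL3 : Real.log θ < 3 := (Real.log_lt_iff_lt_exp (by linarith)).2 hθ2
  have hn0 : (0 : ℝ) < n := by exact_mod_cast hn.1
  obtain ⟨m, hm1, hm2⟩ := exists_int_of_mem_Atheta hθ1 hn
  have hα : Irrational (2 / Real.log θ) := by
    simpa using hirr.natCast_div (m := 2) two_ne_zero
  generalize hα_def : 2 / Real.log θ = α at hα ⊢
  have hnL : (n : ℝ) / Real.log θ = n * α / 2 := by rw [← hα_def]; ring
  rw [hnL] at hm1 hm2
  have hlow : 0 < (2 * m + 1 : ℝ) / n - α := by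
    rw [sub_pos, lt_div_iff₀ hn0]
    linarith
  have hupp : (2 * m + 1 : ℝ) / n - α < Real.log θ / (6 * n ^ 2) := by
    rw [sub_lt_iff_lt_add, div_lt_iff₀ hn0]
    have : (Real.log θ / (6 * n ^ 2) + α) * n = 2 * (Real.log θ / (12 * n)) + n * α := by
      field_simp
      ring
    linarith
  obtain ⟨q, hq⟩ : ∃ q : ℚ, q = ((2 * m + 1 : ℤ) : ℚ) / ((n : ℤ) : ℚ) := ⟨_, rfl⟩
  have hqR : (q : ℝ) = (2 * m + 1 : ℝ) / n := by rw [hq]; push_cast; rfl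
  have hden : (q.den : ℝ) ≤ n := by
    have h : (q.den : ℤ) ∣ n := by
      rw [hq, ← Rat.divInt_eq_div]
      exact Rat.den_dvd _ _
    exact_mod_cast Int.le_of_dvd (by exact_mod_cast hn.1) h
  have hden0 : (0 : ℝ) < q.den := by exact_mod_cast q.den_pos
  obtain ⟨j, hj⟩ : ∃ j, q = α.convergent j := by
    refine Real.exists_rat_eq_convergent ?_
    rw [abs_sub_comm, hqR, abs_of_pos hlow]
    calc _ < _ := hupp
      _ ≤ 1 / (2 * n ^ 2) := by
        rw [div_le_div_iff₀ (by positivity) (by positivity)]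
        nlinarith [pow_pos hn0 2]
      _ ≤ _ := by gcongr
  have hconv : ((cfConv α j).1 : ℝ) / (cfConv α j).2 = (2 * m + 1 : ℝ) / n := by
    rw [cfConv_div_eq_convergent hα, ← hj, hqR]
  have hodd : ¬ Even j := by
    rw [← cfConv_div_lt_iff_even hα, hconv]
    linarith
  obtain ⟨i, rfl⟩ := Nat.not_even_iff_odd.1 hodd
  have hB := cfConv_snd_pos hα (2 * i + 1)
  have hBR : (0 : ℝ) < (cfConv α (2 * i + 1)).2 := by exact_mod_cast hB
  have hcross : (cfConv α (2 * i + 1)).1 * n = (2 * m + 1) * (cfConv α (2 * i + 1)).2 := by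
    rw [div_eq_div_iff hBR.ne' hn0.ne'] at hconv
    exact_mod_cast hconv
  obtain ⟨c, hc⟩ : (cfConv α (2 * i + 1)).2 ∣ (n : ℤ) :=
    (isCoprime_cfConv α (2 * i + 1)).symm.dvd_of_dvd_mul_left (Dvd.intro_left _ hcross.symm)
  have hc0 : 0 < c := by
    have : 0 < (cfConv α (2 * i + 1)).2 * c := hc ▸ by exact_mod_cast hn.1
    exact pos_of_mul_pos_right this hB.le
  lift c to ℕ using hc0.le
  have hnR : (n : ℝ) = (cfConv α (2 * i + 1)).2 * c := by exact_mod_cast hc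
  refine ⟨c, i + 1, by exact_mod_cast hc0, i.succ_pos, ?_⟩
  rw [show 2 * (i + 1) - 1 = 2 * i + 1 by omega, hconv]
  refine ⟨by rw [hc, mul_comm], hlow, hupp.trans_eq ?_⟩
  rw [hnR]
  ring
end

section
/- Let θ be real with 1 < θ < e⁶ and log θ irrational, let A_k/B_k denote the convergents (in lowest terms) of the simple continued fraction expansion of 2/log θ, and let 0 < δ < log θ. Suppose k ≥ 3 satisfies B_{2k−1}² > (log θ)³/(60δ) and 0 < A_{2k−1}/B_{2k−1} − 2/log θ ≤ (log θ − δ)/(6 B_{2k−1}²) (the latter being equivalent to λ_{2k} ≥ 6/(log θ − δ) in the paper's notation). Then B_{2k−1} ∈ Q_θ ∪ A_θ, where Q_θ = {n ∈ ℕ, n ≥ 1 : there exists an integer m with 0 < m − n/log θ < 1/(2n)}. -/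
/-- `Q_θ`: positive integers `n` such that some integer `m` satisfies
`0 < m - n/log θ < 1/(2n)`. -/
noncomputable def Qtheta (θ : ℝ) : Set ℕ :=
  {n | 0 < n ∧ ∃ m : ℤ,
    0 < (m : ℝ) - (n : ℝ) / Real.log θ ∧
    (m : ℝ) - (n : ℝ) / Real.log θ < 1 / (2 * n)}

theorem nonneg_of_hasDerivAt_nonneg {f f' : ℝ → ℝ} (h0 : f 0 = 0)
    (hf : ∀ x, HasDerivAt f (f' x) x) (hf' : ∀ x, 0 < x → 0 ≤ f' x) {x : ℝ} (hx : 0 ≤ x) :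
    0 ≤ f x := by
  have hmono : MonotoneOn f (Set.Ici 0) := by
    refine monotoneOn_of_deriv_nonneg (convex_Ici 0)
      (fun y _ => (hf y).continuousAt.continuousWithinAt)
      (fun y _ => (hf y).differentiableAt.differentiableWithinAt) fun y hy => ?_
    rw [interior_Ici] at hy
    rw [(hf y).deriv]
    exact hf' y hy
  simpa [h0] using hmono Set.self_mem_Ici (Set.mem_Ici.mpr hx) hx

theorem sinh_le_mul_cosh {y : ℝ} (hy : 0 ≤ y) : 0 ≤ y * Real.cosh y - Real.sinh y := by
  refine nonneg_of_hasDerivAt_nonneg (f := fun y => y * Real.cosh y - Real.sinh y)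
    (f' := fun y => y * Real.sinh y) (by simp) (fun x => ?_) (fun x hx => ?_) hy
  · refine HasDerivAt.congr_deriv (((hasDerivAt_id' x).mul (Real.hasDerivAt_cosh x)).sub (Real.hasDerivAt_sinh x)) ?_
    simp
  · exact mul_nonneg hx.le (Real.sinh_nonneg_iff.mpr hx.le)

theorem cubic_mul_cosh_le_quadratic_mul_sinh {y : ℝ} (hy : 0 ≤ y) :
    0 ≤ (1 + 4 / 15 * y ^ 2) * Real.sinh y - (y - y ^ 3 / 15) * Real.cosh y := by
  refine nonneg_of_hasDerivAt_nonneg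
    (f := fun y => (1 + 4 / 15 * y ^ 2) * Real.sinh y - (y - y ^ 3 / 15) * Real.cosh y)
    (f' := fun y => y / 15 * (7 * (y * Real.cosh y - Real.sinh y) + y ^ 2 * Real.sinh y))
    (by simp) (fun x => ?_) (fun x hx => ?_) hy
  · have hp : HasDerivAt (fun y : ℝ => 1 + 4 / 15 * y ^ 2) (8 / 15 * x) x := by
      refine HasDerivAt.congr_deriv (((hasDerivAt_pow 2 x).const_mul (4 / 15)).const_add 1) ?_
      push_cast
      ring
    have hq : HasDerivAt (fun y : ℝ => y - y ^ 3 / 15) (1 - x ^ 2 / 5) x := by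
      refine HasDerivAt.congr_deriv ((hasDerivAt_id' x).sub ((hasDerivAt_pow 3 x).div_const 15)) ?_
      push_cast
      ring
    refine HasDerivAt.congr_deriv ((hp.mul (Real.hasDerivAt_sinh x)).sub (hq.mul (Real.hasDerivAt_cosh x))) ?_
    ring
  · have h1 := sinh_le_mul_cosh hx.le
    have h2 := Real.sinh_nonneg_iff.mpr hx.le
    positivity

theorem quartic_mul_sinh_le_mul_cosh {y : ℝ} (hy : 0 ≤ y) :
    0 ≤ y * Real.cosh y - (1 + y ^ 2 / 3 - y ^ 4 / 45) * Real.sinh y := by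
  refine nonneg_of_hasDerivAt_nonneg
    (f := fun y => y * Real.cosh y - (1 + y ^ 2 / 3 - y ^ 4 / 45) * Real.sinh y)
    (f' := fun y => y / 3 *
      ((1 + 4 / 15 * y ^ 2) * Real.sinh y - (y - y ^ 3 / 15) * Real.cosh y))
    (by simp) (fun x => ?_) (fun x hx => ?_) hy
  · have hp : HasDerivAt (fun y : ℝ => 1 + y ^ 2 / 3 - y ^ 4 / 45)
        (2 / 3 * x - 4 / 45 * x ^ 3) x := by
      refine HasDerivAt.congr_deriv ((((hasDerivAt_pow 2 x).div_const 3).const_add 1).sub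
        ((hasDerivAt_pow 4 x).div_const 45)) ?_
      push_cast
      ring
    refine HasDerivAt.congr_deriv (((hasDerivAt_id' x).mul (Real.hasDerivAt_cosh x)).sub
      (hp.mul (Real.hasDerivAt_sinh x))) ?_
    ring
  · exact mul_nonneg (by positivity) (cubic_mul_cosh_le_quadratic_mul_sinh hx.le)

/-- The Bernoulli expansion of `1 / (exp x - 1)`, truncated after the cubic term,
is a lower bound. -/
theorem bernoulli_lower_bound_inv_exp_sub_one {x : ℝ} (hx : 0 < x) :
    x⁻¹ - 1 / 2 + x / 12 - x ^ 3 / 720 ≤ (Real.exp x - 1)⁻¹ := by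
  obtain ⟨y, rfl⟩ : ∃ y, x = 2 * y := ⟨x / 2, by ring⟩
  have hy : 0 < y := by linarith
  have hs : 0 < Real.sinh y := Real.sinh_pos_iff.mpr hy
  have hexp : Real.exp (2 * y) - 1 = 2 * Real.sinh y * Real.exp y := by
    rw [two_mul, Real.exp_add, Real.sinh_eq]
    have := Real.exp_add y (-y)
    simp only [add_neg_cancel, Real.exp_zero] at this
    linear_combination -this
  have hinv : (Real.exp (2 * y) - 1)⁻¹ = Real.cosh y / (2 * Real.sinh y) - 1 / 2 := by
    rw [hexp, mul_inv, ← Real.exp_neg, ← Real.cosh_sub_sinh]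
    field_simp
  have hdiff : (Real.exp (2 * y) - 1)⁻¹ -
      ((2 * y)⁻¹ - 1 / 2 + 2 * y / 12 - (2 * y) ^ 3 / 720) =
      (y * Real.cosh y - (1 + y ^ 2 / 3 - y ^ 4 / 45) * Real.sinh y) /
        (2 * y * Real.sinh y) := by
    rw [hinv]
    field_simp
    ring
  have := div_nonneg (quartic_mul_sinh_le_mul_cosh hy.le)
    (by positivity : 0 ≤ 2 * y * Real.sinh y)
  linarith

theorem cfA_succ_nonneg (α : ℝ) (k : ℕ) : 0 ≤ cfA α (k + 1) :=
  Int.floor_nonneg.mpr (inv_nonneg.mpr (Int.fract_nonneg _))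

theorem cfConv_snd_nonneg (α : ℝ) : ∀ k, 0 ≤ (cfConv α k).2
  | 0 => by simp [cfConv]
  | 1 => cfA_succ_nonneg α 0
  | k + 2 => add_nonneg (mul_nonneg (cfA_succ_nonneg α (k + 1)) (cfConv_snd_nonneg α (k + 1)))
      (cfConv_snd_nonneg α k)

/-- If `a / n` approximates `2 / log θ` well enough from above, then `n` lies
in `Q_θ` or `A_θ`, according to the parity of the numerator `a`. -/
theorem mem_Qtheta_union_Atheta {θ δ : ℝ} (hθ1 : 1 < θ) (hθ2 : θ < Real.exp 6) (hδ0 : 0 < δ)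
    {n : ℕ} (hn : 0 < n) (a : ℤ) (hB : (Real.log θ) ^ 3 / (60 * δ) < (n : ℝ) ^ 2)
    (hlow : 0 < (a : ℝ) / n - 2 / Real.log θ)
    (hhigh : (a : ℝ) / n - 2 / Real.log θ ≤ (Real.log θ - δ) / (6 * (n : ℝ) ^ 2)) :
    n ∈ Qtheta θ ∪ Atheta θ := by
  have hθ0 : 0 < θ := by linarith
  have hL0 : 0 < Real.log θ := Real.log_pos hθ1
  have hL6 : Real.log θ < 6 := (Real.log_lt_iff_lt_exp hθ0).mpr hθ2
  have hpow : θ ^ ((n : ℝ))⁻¹ = Real.exp (Real.log θ / n) := by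
    rw [Real.rpow_def_of_pos hθ0, div_eq_mul_inv]
  have hn0 : (0 : ℝ) < n := by exact_mod_cast hn
  simp only [Set.mem_union, Qtheta, Atheta, Set.mem_ofPred_eq, hpow]
  generalize Real.log θ = L at *
  generalize (n : ℝ) = b at *
  have hscale : (a : ℝ) / 2 - b / L = b / 2 * (a / b - 2 / L) := by
    field_simp
  have hpos : 0 < (a : ℝ) / 2 - b / L := by
    rw [hscale]
    positivity
  have hle : (a : ℝ) / 2 - b / L ≤ (L - δ) / (12 * b) := by
    rw [hscale]
    calc b / 2 * (a / b - 2 / L) ≤ b / 2 * ((L - δ) / (6 * b ^ 2)) := by gcongr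
      _ = (L - δ) / (12 * b) := by
        field_simp
        ring
  obtain ⟨m, rfl | rfl⟩ := Int.even_or_odd' a
  · left
    push_cast at hpos hle
    refine ⟨hn, m, by linarith, ?_⟩
    have : (L - δ) / (12 * b) < 1 / (2 * b) := by
      rw [div_lt_div_iff₀ (by positivity) (by positivity)]
      nlinarith
    linarith
  · right
    push_cast at hpos hle
    refine ⟨hn, ne_of_gt ?_⟩
    have hlt : ⌊b / L - 1 / 2⌋ < m := Int.floor_lt.mpr (by linarith)
    refine hlt.trans_le (Int.le_floor.mpr ?_)
    have hbern := bernoulli_lower_bound_inv_exp_sub_one (div_pos hL0 hn0)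
    rw [inv_div] at hbern
    have hcub : (L - δ) / (12 * b) ≤ L / b / 12 - (L / b) ^ 3 / 720 := by
      rw [div_lt_iff₀ (by positivity)] at hB
      have heq : L / b / 12 - (L / b) ^ 3 / 720 - (L - δ) / (12 * b) =
          (b ^ 2 * (60 * δ) - L ^ 3) / (720 * b ^ 3) := by
        field_simp
        ring
      have : 0 ≤ (b ^ 2 * (60 * δ) - L ^ 3) / (720 * b ^ 3) :=
        div_nonneg (by linarith) (by positivity)
      linarith
    linarith

theorem stmt14 (θ : ℝ) (hθ1 : 1 < θ) (hθ2 : θ < Real.exp 6)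
    (hirr : Irrational (Real.log θ)) (δ : ℝ) (hδ0 : 0 < δ) (hδ : δ < Real.log θ)
    (k : ℕ) (hk : 3 ≤ k)
    (hB : (Real.log θ) ^ 3 / (60 * δ) <
      ((cfConv (2 / Real.log θ) (2 * k - 1)).2 : ℝ) ^ 2)
    (hlow : 0 < ((cfConv (2 / Real.log θ) (2 * k - 1)).1 : ℝ) /
        ((cfConv (2 / Real.log θ) (2 * k - 1)).2 : ℝ) - 2 / Real.log θ)
    (hhigh : ((cfConv (2 / Real.log θ) (2 * k - 1)).1 : ℝ) /
        ((cfConv (2 / Real.log θ) (2 * k - 1)).2 : ℝ) - 2 / Real.log θ ≤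
      (Real.log θ - δ) / (6 * ((cfConv (2 / Real.log θ) (2 * k - 1)).2 : ℝ) ^ 2)) :
    (cfConv (2 / Real.log θ) (2 * k - 1)).2.toNat ∈ Qtheta θ ∪ Atheta θ := by
  have hL0 : 0 < Real.log θ := Real.log_pos hθ1
  have hnonneg := cfConv_snd_nonneg (2 / Real.log θ) (2 * k - 1)
  have hne : (cfConv (2 / Real.log θ) (2 * k - 1)).2 ≠ 0 := by
    intro h
    rw [h] at hB
    have : 0 < (Real.log θ) ^ 3 / (60 * δ) := by positivity
    norm_num at hB
    linarith
  have hcast : (((cfConv (2 / Real.log θ) (2 * k - 1)).2.toNat : ℕ) : ℝ) =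
      ((cfConv (2 / Real.log θ) (2 * k - 1)).2 : ℝ) := by
    exact_mod_cast Int.toNat_of_nonneg hnonneg
  refine mem_Qtheta_union_Atheta hθ1 hθ2 hδ0 (by omega)
    (cfConv (2 / Real.log θ) (2 * k - 1)).1 ?_ ?_ ?_ <;> rwa [hcast]
end
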